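/- arXiv:2307.01839 — 2 statements merged into one kernel-verified Lean document; each statement's English description precedes it below -/
import Mathlib

section
/- For d ≥ 2, κ_i ≥ 0 (i = 1,…,d+1) and any integer 1 ≤ ℓ ≤ d, the spectral operator D_κ admits the decomposition: for every twice continuously differentiable f on △^d and every x in the interior of △^d, D_κ f(x) = (1/W_κ(x)) [ (1−x_ℓ)^{−d} (⟨x,∇⟩ − ∂_ℓ)( x_ℓ (1−x_ℓ)^{d−1} W_κ(x) (⟨x,∇⟩ − ∂_ℓ) f(x) ) + (1−x_ℓ)^{−1} Σ_{1≤i≤d, i≠ℓ} ∂_i( x_i (1−|x|) W_κ(x) ∂_i f(x) ) + (1−x_ℓ)^{−1} Σ_{1≤i<j≤d, i≠ℓ, j≠ℓ} ∂_{i,j}( x_i x_j W_κ(x) ∂_{i,j} f(x) ) ], where ⟨x,∇⟩ = Σ_{i=1}^d x_i ∂_i. -/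
open MeasureTheory Finset

noncomputable section

/-- The simplex `△^d = {x : x_i ≥ 0, x_1 + ⋯ + x_d ≤ 1}`. -/
def Splx (d : ℕ) : Set (Fin d → ℝ) := {x | (∀ i, 0 ≤ x i) ∧ ∑ i, x i ≤ 1}

/-- The `i`-th partial derivative. -/
def pd {d : ℕ} (i : Fin d) (f : (Fin d → ℝ) → ℝ) : (Fin d → ℝ) → ℝ :=
  fun x => fderiv ℝ f x (Pi.single i 1)

/-- `∂_{i,j} = ∂_i - ∂_j`. -/
def pdd {d : ℕ} (i j : Fin d) (f : (Fin d → ℝ) → ℝ) : (Fin d → ℝ) → ℝ :=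
  fun x => pd i f x - pd j f x

/-- `⟨x,∇⟩ = ∑ x_i ∂_i`. -/
def xgrad {d : ℕ} (f : (Fin d → ℝ) → ℝ) : (Fin d → ℝ) → ℝ :=
  fun x => ∑ i, x i * pd i f x

/-- The Jacobi weight `W_κ(x) = x_1^{κ_1} ⋯ x_d^{κ_d} (1-|x|)^{κ_{d+1}}`. -/
def Wk {d : ℕ} (κ : Fin (d+1) → ℝ) (x : Fin d → ℝ) : ℝ :=
  (∏ i : Fin d, x i ^ κ i.castSucc) * (1 - ∑ i, x i) ^ κ (Fin.last d)

/-- The spectral operator `D_κ`. -/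
def Dk {d : ℕ} (κ : Fin (d+1) → ℝ) (f : (Fin d → ℝ) → ℝ) (x : Fin d → ℝ) : ℝ :=
  (∑ i, x i * (1 - x i) * pd i (pd i f) x)
    - 2 * ∑ i, ∑ j ∈ Finset.univ.filter (fun j => i < j), x i * x j * pd i (pd j f) x
    + ∑ i, (κ i.castSucc + 1 - ((∑ k, κ k) + (d : ℝ) + 1) * x i) * pd i f x

/-- The normalizing constant `b_κ`. -/
def bk {d : ℕ} (κ : Fin (d+1) → ℝ) : ℝ :=
  Real.Gamma ((∑ i, κ i) + (d : ℝ) + 1) / ∏ i, Real.Gamma (κ i + 1)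

/-- The inner product `⟨f,g⟩_κ = b_κ ∫_{△^d} f g W_κ`. -/
def ipk {d : ℕ} (κ : Fin (d+1) → ℝ) (f g : (Fin d → ℝ) → ℝ) : ℝ :=
  bk κ * ∫ x in Splx d, f x * g x * Wk κ x

/-- The norm `‖f‖_{κ,2}`. -/
def nrm2 {d : ℕ} (κ : Fin (d+1) → ℝ) (f : (Fin d → ℝ) → ℝ) : ℝ :=
  Real.sqrt (ipk κ f f)

/-- Membership in `V_n^d(W_κ)`: a polynomial of degree (at most) `n` orthogonal to all
polynomials of lower degree. -/
def InVn (d n : ℕ) (κ : Fin (d+1) → ℝ) (f : MvPolynomial (Fin d) ℝ) : Prop :=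
  f.totalDegree ≤ n ∧ ∀ g : MvPolynomial (Fin d) ℝ, g.totalDegree < n →
    ipk κ (fun x => MvPolynomial.eval x f) (fun x => MvPolynomial.eval x g) = 0

/-- `x_k` for `1 ≤ k ≤ d+1`, with the convention `x_{d+1} = 1 - |x|`. -/
def xe {d : ℕ} (x : Fin d → ℝ) (k : Fin (d+1)) : ℝ :=
  if h : (k : ℕ) < d then x ⟨(k : ℕ), h⟩ else 1 - ∑ i, x i

theorem exists_pos_add_smul_mem_of_mem_interior {E : Type*} [NormedAddCommGroup E]
    [NormedSpace ℝ E] {s : Set E} {x : E} (hx : x ∈ interior s) (w : E) :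
    ∃ t : ℝ, 0 < t ∧ x + t • w ∈ s := by
  have h1 : Filter.Tendsto (fun t : ℝ => x + t • w) (nhdsWithin 0 (Set.Ioi 0)) (nhds x) := by
    have : Continuous fun t : ℝ => x + t • w := by fun_prop
    have h := this.tendsto 0
    simp only [zero_smul, add_zero] at h
    exact h.mono_left nhdsWithin_le_nhds
  obtain ⟨t, ht, ht0⟩ :=
    ((h1.eventually (mem_interior_iff_mem_nhds.mp hx)).and self_mem_nhdsWithin).exists
  exact ⟨t, ht0, ht⟩

theorem pos_of_mem_interior_Splx {d : ℕ} {x : Fin d → ℝ} (hx : x ∈ interior (Splx d))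
    (i : Fin d) : 0 < x i := by
  obtain ⟨t, ht, h, -⟩ := exists_pos_add_smul_mem_of_mem_interior hx (-Pi.single i 1)
  have := h i
  simp at this
  linarith

theorem sum_lt_one_of_mem_interior_Splx {d : ℕ} {x : Fin d → ℝ} (hx : x ∈ interior (Splx d))
    (i : Fin d) : ∑ k, x k < 1 := by
  obtain ⟨t, ht, -, h⟩ := exists_pos_add_smul_mem_of_mem_interior hx (Pi.single i 1)
  simp [Finset.sum_add_distrib, ← Finset.mul_sum] at h
  linarith

theorem xgrad_eq_fderiv {d : ℕ} (f : (Fin d → ℝ) → ℝ) (x : Fin d → ℝ) :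
    xgrad f x = fderiv ℝ f x x := by
  have h : fderiv ℝ f x x = fderiv ℝ f x (∑ i, x i • Pi.single i 1) :=
    congrArg _ (pi_eq_sum_univ' x)
  simp [h, xgrad, pd, map_sum]

/-- The logarithmic derivative of the Jacobi weight along a vector. -/
theorem hasFDerivAt_Wk {d : ℕ} (κ : Fin (d+1) → ℝ) {x : Fin d → ℝ} (hx : ∀ i, 0 < x i)
    (hs : ∑ i, x i < 1) :
    HasFDerivAt (Wk κ) (Wk κ x • (∑ i, (κ i.castSucc / x i) • ContinuousLinearMap.proj (R := ℝ)
      (φ := fun _ : Fin d => ℝ) i - (κ (Fin.last d) / (1 - ∑ i, x i)) •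
        ∑ i, ContinuousLinearMap.proj (R := ℝ) (φ := fun _ : Fin d => ℝ) i)) x := by
  have hs' : 0 < 1 - ∑ i, x i := by linarith
  have h1 : ∀ i : Fin d, HasFDerivAt (fun y : Fin d → ℝ => y i ^ κ i.castSucc)
      ((κ i.castSucc * x i ^ (κ i.castSucc - 1)) •
        ContinuousLinearMap.proj (R := ℝ) (φ := fun _ : Fin d => ℝ) i) x := fun i =>
    (hasFDerivAt_apply i x).rpow_const (Or.inl (hx i).ne')
  have h2 : HasFDerivAt (fun y : Fin d → ℝ => 1 - ∑ i, y i)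
      (-∑ i, ContinuousLinearMap.proj (R := ℝ) (φ := fun _ : Fin d => ℝ) i) x :=
    (HasFDerivAt.fun_sum fun i _ => hasFDerivAt_apply i x).const_sub 1
  have h3 := h2.rpow_const (p := κ (Fin.last d)) (Or.inl hs'.ne')
  have h4 := (HasFDerivAt.finsetProd (u := Finset.univ) fun i _ => h1 i).mul h3
  refine h4.congr_fderiv ?_
  ext v
  have h5 : ∀ i : Fin d, (∏ j ∈ Finset.univ.erase i, x j ^ κ j.castSucc) *
      (κ i.castSucc * x i ^ (κ i.castSucc - 1) * v i)
      = (∏ j, x j ^ κ j.castSucc) * (κ i.castSucc / x i * v i) := fun i => by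
    rw [← Finset.mul_prod_erase _ _ (Finset.mem_univ i), Real.rpow_sub_one (hx i).ne']
    ring
  simp [Wk, h5, ← Finset.mul_sum, Real.rpow_sub_one hs'.ne']
  ring

theorem fderiv_Wk {d : ℕ} (κ : Fin (d+1) → ℝ) {x : Fin d → ℝ} (hx : ∀ i, 0 < x i)
    (hs : ∑ i, x i < 1) (v : Fin d → ℝ) :
    fderiv ℝ (Wk κ) x v = Wk κ x * (∑ i, κ i.castSucc / x i * v i
      - κ (Fin.last d) / (1 - ∑ i, x i) * ∑ i, v i) := by
  rw [(hasFDerivAt_Wk κ hx hs).fderiv]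
  simp

theorem fderiv_mul_mul_apply {E : Type*} [NormedAddCommGroup E] [NormedSpace ℝ E]
    {a b c : E → ℝ} {x : E} (ha : DifferentiableAt ℝ a x) (hb : DifferentiableAt ℝ b x)
    (hc : DifferentiableAt ℝ c x) (v : E) :
    fderiv ℝ (fun y => a y * b y * c y) x v =
      fderiv ℝ a x v * b x * c x + a x * fderiv ℝ b x v * c x + a x * b x * fderiv ℝ c x v := by
  rw [fderiv_fun_mul (ha.fun_mul hb) hc, fderiv_fun_mul ha hb]
  simp
  ring

theorem two_mul_sum_sum_lt {ι : Type*} [LinearOrder ι] (s : Finset ι) (F : ι → ι → ℝ)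
    (hF : ∀ i j, F i j = F j i) :
    2 * ∑ i ∈ s, ∑ j ∈ s with i < j, F i j = ∑ i ∈ s, ∑ j ∈ s, F i j - ∑ i ∈ s, F i i := by
  have h1 : ∑ i ∈ s, ∑ j ∈ s with j < i, F i j = ∑ i ∈ s, ∑ j ∈ s with i < j, F i j := by
    simp only [Finset.sum_filter]
    rw [Finset.sum_comm]
    simp only [hF]
  have h2 : ∀ i ∈ s, ∑ j ∈ s, F i j
      = ∑ j ∈ s with i < j, F i j + ∑ j ∈ s with j < i, F i j + F i i := fun i hi => by
    have h3 : F i i = ∑ j ∈ s, if i = j then F i j else 0 := by simp [hi]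
    rw [h3, Finset.sum_filter, Finset.sum_filter, ← Finset.sum_add_distrib,
      ← Finset.sum_add_distrib]
    refine Finset.sum_congr rfl fun j _ => ?_
    rcases lt_trichotomy i j with h | h | h
    · simp [h, h.not_gt, h.ne]
    · simp [h]
    · simp [h, h.not_gt, h.ne']
  rw [Finset.sum_congr rfl h2, Finset.sum_add_distrib, Finset.sum_add_distrib, h1]
  ring

/-- The sum over pairs of the expanded terms `∂_{i,j}(x_i x_j W ∂_{i,j} f) / W`. -/
theorem sum_sum_pair_expansion {ι : Type*} (s : Finset ι) (x k g : ι → ℝ) (h : ι → ι → ℝ) :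
    ∑ i ∈ s, ∑ j ∈ s, (((1 + k i) * x j - (1 + k j) * x i) * (g i - g j)
        + x i * x j * (h i i + h j j - 2 * h i j))
      = 2 * ((∑ i ∈ s, x i) * ∑ i ∈ s, (1 + k i) * g i
        - (∑ i ∈ s, (1 + k i)) * ∑ i ∈ s, x i * g i
        + (∑ i ∈ s, x i) * ∑ i ∈ s, x i * h i i - ∑ i ∈ s, ∑ j ∈ s, x i * x j * h i j) := by
  have h1 : ∀ i j, ((1 + k i) * x j - (1 + k j) * x i) * (g i - g j)
        + x i * x j * (h i i + h j j - 2 * h i j)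
      = ((1 + k i) * g i) * x j + x i * ((1 + k j) * g j) - (x i * g i) * (1 + k j)
        - (1 + k i) * (x j * g j) + (x i * h i i) * x j + x i * (x j * h j j)
        - 2 * (x i * x j * h i j) := fun i j => by ring
  simp only [h1, Finset.sum_add_distrib, Finset.sum_sub_distrib, ← Finset.mul_sum,
    ← Finset.sum_mul]
  ring

theorem fderiv_fderiv_apply {E : Type*} [NormedAddCommGroup E] [NormedSpace ℝ E] {f : E → ℝ}
    {x : E} (hf : DifferentiableAt ℝ (fderiv ℝ f) x) (w v : E) :
    fderiv ℝ (fun y => fderiv ℝ f y w) x v = fderiv ℝ (fderiv ℝ f) x v w := by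
  rw [(hf.hasFDerivAt.clm_apply (hasFDerivAt_const w x)).fderiv]
  simp

theorem pd_pd_eq {d : ℕ} {f : (Fin d → ℝ) → ℝ} {x : Fin d → ℝ}
    (hf : DifferentiableAt ℝ (fderiv ℝ f) x) (i j : Fin d) :
    pd i (pd j f) x = fderiv ℝ (fderiv ℝ f) x (Pi.single i 1) (Pi.single j 1) :=
  fderiv_fderiv_apply hf _ _

theorem pdd_weighted_pdd {d : ℕ} (κ : Fin (d+1) → ℝ) {x : Fin d → ℝ}
    (hx : ∀ i, 0 < x i) (hs : ∑ i, x i < 1) {f : (Fin d → ℝ) → ℝ}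
    (hf : DifferentiableAt ℝ (fderiv ℝ f) x)
    (hsymm : ∀ u v, fderiv ℝ (fderiv ℝ f) x u v = fderiv ℝ (fderiv ℝ f) x v u) (i j : Fin d) :
    pdd i j (fun y => y i * y j * Wk κ y * pdd i j f y) x = Wk κ x *
      (((1 + κ i.castSucc) * x j - (1 + κ j.castSucc) * x i) * (pd i f x - pd j f x)
        + x i * x j * (pd i (pd i f) x + pd j (pd j f) x - 2 * pd i (pd j f) x)) := by
  rcases eq_or_ne i j with rfl | hij
  · simp only [pdd]
    ring
  have hb : (fun y => pdd i j f y) = fun y => fderiv ℝ f y (Pi.single i 1 - Pi.single j 1) := by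
    ext y
    simp [pdd, pd]
  have hbd : DifferentiableAt ℝ (fun y => pdd i j f y) x := by
    rw [hb]
    exact hf.clm_apply (differentiableAt_const _)
  have had : HasFDerivAt (fun y : Fin d → ℝ => y i * y j) _ x :=
    (hasFDerivAt_apply (𝕜 := ℝ) i x).fun_mul (hasFDerivAt_apply j x)
  have hxi := (hx i).ne'
  have hxj := (hx j).ne'
  have key := fderiv_mul_mul_apply had.differentiableAt
    (hasFDerivAt_Wk κ hx hs).differentiableAt hbd (Pi.single i 1 - Pi.single j 1)
  have hL : pdd i j (fun y => y i * y j * Wk κ y * pdd i j f y) x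
      = fderiv ℝ (fun y => y i * y j * Wk κ y * pdd i j f y) x
        (Pi.single i 1 - Pi.single j 1) := by
    rw [map_sub]
    rfl
  rw [hL, key, had.fderiv, fderiv_Wk κ hx hs, hb, fderiv_fderiv_apply hf, pd_pd_eq hf,
    pd_pd_eq hf, pd_pd_eq hf]
  simp only [map_sub, _root_.sub_apply, hsymm (Pi.single j 1) (Pi.single i 1)]
  simp [pdd, pd, mul_sub, Finset.sum_sub_distrib, Pi.single_apply, hij, hij.symm]
  field_simp
  ring

theorem pd_weighted_pd {d : ℕ} (κ : Fin (d+1) → ℝ) {x : Fin d → ℝ}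
    (hx : ∀ i, 0 < x i) (hs : ∑ i, x i < 1) {f : (Fin d → ℝ) → ℝ}
    (hf : DifferentiableAt ℝ (fderiv ℝ f) x) (i : Fin d) :
    pd i (fun y => y i * (1 - ∑ k, y k) * Wk κ y * pd i f y) x = Wk κ x *
      ((1 - ∑ k, x k) * ((1 + κ i.castSucc) * pd i f x)
        - (1 + κ (Fin.last d)) * (x i * pd i f x)
        + (1 - ∑ k, x k) * (x i * pd i (pd i f) x)) := by
  have hbd : DifferentiableAt ℝ (fun y => pd i f y) x := hf.clm_apply (differentiableAt_const _)
  have had : HasFDerivAt (fun y : Fin d → ℝ => y i * (1 - ∑ k, y k)) _ x :=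
    (hasFDerivAt_apply (𝕜 := ℝ) i x).fun_mul
      ((HasFDerivAt.fun_sum fun k _ => hasFDerivAt_apply k x).const_sub 1)
  have hxi := (hx i).ne'
  have hs' : 1 - ∑ k, x k ≠ 0 := by linarith
  have key := fderiv_mul_mul_apply had.differentiableAt
    (hasFDerivAt_Wk κ hx hs).differentiableAt hbd (Pi.single i 1)
  have h2 : fderiv ℝ (fun y => pd i f y) x (Pi.single i 1) = pd i (pd i f) x := rfl
  change fderiv ℝ (fun y => y i * (1 - ∑ k, y k) * Wk κ y * pd i f y) x (Pi.single i 1) = _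
  rw [key, h2, had.fderiv, fderiv_Wk κ hx hs]
  simp [Pi.single_apply]
  field_simp
  ring

theorem xgrad_sub_pd_weighted {d : ℕ} (κ : Fin (d+1) → ℝ) {x : Fin d → ℝ}
    (hx : ∀ i, 0 < x i) (hs : ∑ i, x i < 1) {f : (Fin d → ℝ) → ℝ}
    (hf : DifferentiableAt ℝ (fderiv ℝ f) x) (n : ℕ) (l : Fin d) :
    xgrad (fun y => y l * (1 - y l) ^ (n + 1) * Wk κ y * (xgrad f y - pd l f y)) x
        - pd l (fun y => y l * (1 - y l) ^ (n + 1) * Wk κ y * (xgrad f y - pd l f y)) x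
      = Wk κ x * (1 - x l) ^ (n + 1) *
        ((-(1 - x l) + (n + 2) * x l + x l * ∑ k, κ k - κ l.castSucc)
            * fderiv ℝ f x (x - Pi.single l 1)
          + x l * fderiv ℝ (fderiv ℝ f) x (x - Pi.single l 1) (x - Pi.single l 1)) := by
  have hb : (fun y => xgrad f y - pd l f y) = fun y => fderiv ℝ f y (y - Pi.single l 1) := by
    ext y
    simp [xgrad_eq_fderiv, pd]
  have hbd := hf.hasFDerivAt.clm_apply ((hasFDerivAt_id x).sub_const (Pi.single l (1 : ℝ)))
  have had : HasFDerivAt (fun y : Fin d → ℝ => y l * (1 - y l) ^ (n + 1)) _ x :=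
    (hasFDerivAt_apply (𝕜 := ℝ) l x).fun_mul
      (((hasFDerivAt_apply l x).const_sub 1).pow (n + 1))
  have hxl := (hx l).ne'
  have hs' : 1 - ∑ k, x k ≠ 0 := by linarith
  have hW : ∑ i, κ i.castSucc / x i * (x - Pi.single l 1 : Fin d → ℝ) i
      - κ (Fin.last d) / (1 - ∑ i, x i) * ∑ i, (x - Pi.single l 1 : Fin d → ℝ) i
      = ∑ k, κ k - κ l.castSucc / x l := by
    have h1 : ∀ i, κ i.castSucc / x i * x i = κ i.castSucc := fun i =>
      div_mul_cancel₀ _ (hx i).ne'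
    simp [mul_sub, Finset.sum_sub_distrib, Pi.single_apply, h1, Fin.sum_univ_castSucc]
    field_simp
    ring
  have key := fderiv_mul_mul_apply had.differentiableAt
    (hasFDerivAt_Wk κ hx hs).differentiableAt hbd.differentiableAt (x - Pi.single l 1)
  rw [xgrad_eq_fderiv, pd, ← map_sub]
  simp only [fun y => congrFun hb y]
  simp only [id] at key hbd
  rw [key, hbd.fderiv, had.fderiv, fderiv_Wk κ hx hs, hW]
  simp
  field_simp
  ring

theorem sum_sum_pd_pd_eq {d : ℕ} {f : (Fin d → ℝ) → ℝ} {x : Fin d → ℝ}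
    (hf : DifferentiableAt ℝ (fderiv ℝ f) x) (s : Finset (Fin d)) (c : Fin d → ℝ) :
    ∑ i ∈ s, ∑ j ∈ s, c i * c j * pd i (pd j f) x
      = fderiv ℝ (fderiv ℝ f) x (∑ i ∈ s, c i • Pi.single i 1) (∑ i ∈ s, c i • Pi.single i 1) := by
  simp only [pd_pd_eq hf, map_sum, map_smul, _root_.sum_apply, _root_.smul_apply,
    smul_eq_mul, Finset.mul_sum, mul_assoc]
  rw [Finset.sum_comm]
  refine Finset.sum_congr rfl fun i _ => Finset.sum_congr rfl fun j _ => ?_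
  ring

/-- the decomposition of `D_κ` in Corollary 2.3, for `1 ≤ ℓ ≤ d`. -/
theorem stmt8 (d : ℕ) (hd : 2 ≤ d) (κ : Fin (d+1) → ℝ) (hκ : ∀ i, 0 ≤ κ i)
    (l : Fin d) (f : (Fin d → ℝ) → ℝ) (hf : ContDiffOn ℝ 2 f (Splx d))
    (x : Fin d → ℝ) (hx : x ∈ interior (Splx d)) :
    Dk κ f x = (1 / Wk κ x) *
      ((1 / (1 - x l) ^ d) *
          (xgrad (fun y => y l * (1 - y l) ^ (d - 1) * Wk κ y * (xgrad f y - pd l f y)) x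
            - pd l (fun y => y l * (1 - y l) ^ (d - 1) * Wk κ y * (xgrad f y - pd l f y)) x) +
       (1 / (1 - x l)) *
          (∑ i ∈ Finset.univ.filter (fun i => i ≠ l),
              pd i (fun y => y i * (1 - ∑ k, y k) * Wk κ y * pd i f y) x) +
       (1 / (1 - x l)) *
          ∑ i ∈ Finset.univ.filter (fun i => i ≠ l),
            ∑ j ∈ Finset.univ.filter (fun j => i < j ∧ j ≠ l),
              pdd i j (fun y => y i * y j * Wk κ y * pdd i j f y) x) := by
  have hxp := pos_of_mem_interior_Splx hx
  have hs := sum_lt_one_of_mem_interior_Splx hx l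
  have hxl : 0 < 1 - x l := by
    have := Finset.single_le_sum (fun i _ => (hxp i).le) (Finset.mem_univ l)
    linarith
  have hC : ContDiffAt ℝ 2 f x := hf.contDiffAt (mem_interior_iff_mem_nhds.mp hx)
  have hD : DifferentiableAt ℝ (fderiv ℝ f) x :=
    (hC.fderiv_right (m := 1) (by norm_num)).differentiableAt (by norm_num)
  have hsymm : ∀ u v, fderiv ℝ (fderiv ℝ f) x u v = fderiv ℝ (fderiv ℝ f) x v u := fun u v =>
    (hC.isSymmSndFDerivAt (by simp)).eq u v
  have hW : Wk κ x ≠ 0 := by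
    have h1 : 0 < 1 - ∑ i, x i := by linarith
    exact (mul_pos (Finset.prod_pos fun i _ => Real.rpow_pos_of_pos (hxp i) _)
      (Real.rpow_pos_of_pos h1 _)).ne'
  obtain ⟨n, rfl⟩ : ∃ n, d = n + 2 := ⟨d - 2, by omega⟩
  have hn : n + 2 - 1 = n + 1 := rfl
  rw [hn, xgrad_sub_pd_weighted κ hxp hs hD]
  simp only [pd_weighted_pd κ hxp hs hD, pdd_weighted_pdd κ hxp hs hD hsymm,
    ← Finset.mul_sum]
  set A : Finset (Fin (n + 2)) := Finset.univ.filter (fun i => i ≠ l) with hA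
  set D := fderiv ℝ (fderiv ℝ f) x
  set P : Fin (n + 2) → ℝ := ∑ i ∈ A, x i • Pi.single i 1 with hP
  have hsplit : ∀ F : Fin (n + 2) → ℝ, ∑ i, F i = F l + ∑ i ∈ A, F i := fun F => by
    rw [hA, Finset.filter_ne', Finset.add_sum_erase _ _ (Finset.mem_univ l)]
  have hxP : x = x l • Pi.single l 1 + P := by
    conv_lhs => rw [pi_eq_sum_univ' x]
    rw [hP, hA, Finset.filter_ne']
    exact (Finset.add_sum_erase _ (fun i => x i • (Pi.single i 1 : Fin (n + 2) → ℝ))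
      (Finset.mem_univ l)).symm
  have hvP : x - Pi.single l 1 = (x l - 1) • Pi.single l 1 + P := by
    conv_lhs => rw [hxP]
    module
  have hfP : ∑ i ∈ A, x i * pd i f x = fderiv ℝ f x P := by
    simp [hP, pd]
  have hDP : ∑ i ∈ A, ∑ j ∈ A, x i * x j * pd i (pd j f) x = D P P := sum_sum_pd_pd_eq hD A x
  have hpd : ∀ i j, pd i (pd j f) x = pd j (pd i f) x := fun i j => by
    rw [pd_pd_eq hD, pd_pd_eq hD, hsymm]
  have hDk : 2 * ∑ i, ∑ j ∈ Finset.univ.filter (fun j => i < j), x i * x j * pd i (pd j f) x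
      = D x x - ∑ i, x i * x i * pd i (pd i f) x := by
    rw [two_mul_sum_sum_lt Finset.univ (fun i j => x i * x j * pd i (pd j f) x)
      (fun i j => by rw [hpd i j, mul_comm (x i)])]
    rw [sum_sum_pd_pd_eq hD, ← pi_eq_sum_univ' x]
  have hcard : (A.card : ℝ) = n + 1 := by
    simp [hA, Finset.filter_ne']
  have hpairs := sum_sum_pair_expansion A x (fun i => κ i.castSucc) (fun i => pd i f x)
    (fun i j => pd i (pd j f) x)
  have hlt := two_mul_sum_sum_lt A (fun i j =>
      ((1 + κ i.castSucc) * x j - (1 + κ j.castSucc) * x i) * (pd i f x - pd j f x)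
        + x i * x j * (pd i (pd i f) x + pd j (pd j f) x - 2 * pd i (pd j f) x))
    (fun i j => by rw [hpd i j]; ring)
  have hfilter : ∀ i, Finset.univ.filter (fun j => i < j ∧ j ≠ l) = A.filter (fun j => i < j) :=
    fun i => by rw [hA, Finset.filter_filter]; simp only [and_comm]
  simp only [hfilter]
  have hdiag : ∑ i ∈ A, (((1 + κ i.castSucc) * x i - (1 + κ i.castSucc) * x i)
      * (pd i f x - pd i f x)
        + x i * x i * (pd i (pd i f) x + pd i (pd i f) x - 2 * pd i (pd i f) x)) = 0 :=
    Finset.sum_eq_zero fun i _ => by ring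
  rw [hdiag, hpairs, sub_zero] at hlt
  rw [mul_left_cancel₀ two_ne_zero hlt]
  have hll : pd l (pd l f) x = D (Pi.single l 1) (Pi.single l 1) := pd_pd_eq hD l l
  have hxx : D x x = x l ^ 2 * pd l (pd l f) x + 2 * x l * D P (Pi.single l 1) + D P P := by
    conv_lhs => rw [hxP]
    rw [hll]
    simp only [map_add, map_smul, _root_.add_apply, _root_.smul_apply, smul_eq_mul,
      hsymm (Pi.single l 1) P]
    ring
  have hvv : D (x - Pi.single l 1) (x - Pi.single l 1) = (x l - 1) ^ 2 * pd l (pd l f) x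
      + 2 * (x l - 1) * D P (Pi.single l 1) + D P P := by
    rw [hvP, hll]
    simp only [map_add, map_smul, _root_.add_apply, _root_.smul_apply, smul_eq_mul,
      hsymm (Pi.single l 1) P]
    ring
  have hfv : fderiv ℝ f x (x - Pi.single l 1) = (x l - 1) * pd l f x + fderiv ℝ f x P := by
    rw [hvP, pd]
    simp
  have hDk' : Dk κ f x = (x l * pd l (pd l f) x + ∑ i ∈ A, x i * pd i (pd i f) x) - D x x
      + ((1 + κ l.castSucc) * pd l f x + ∑ i ∈ A, (1 + κ i.castSucc) * pd i f x)
      - ((∑ k, κ k) + ((n + 2 : ℕ) : ℝ) + 1) * (x l * pd l f x + fderiv ℝ f x P) := by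
    have h1 : ∑ i, x i * (1 - x i) * pd i (pd i f) x
        = ∑ i, x i * pd i (pd i f) x - ∑ i, x i * x i * pd i (pd i f) x := by
      rw [← Finset.sum_sub_distrib]
      exact Finset.sum_congr rfl fun i _ => by ring
    have h2 : ∑ i, (κ i.castSucc + 1 - ((∑ k, κ k) + ((n + 2 : ℕ) : ℝ) + 1) * x i) * pd i f x
        = ∑ i, (1 + κ i.castSucc) * pd i f x
          - ((∑ k, κ k) + ((n + 2 : ℕ) : ℝ) + 1) * ∑ i, x i * pd i f x := by
      rw [Finset.mul_sum, ← Finset.sum_sub_distrib]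
      exact Finset.sum_congr rfl fun i _ => by ring
    rw [Dk, hDk, h1, h2, ← hfP, ← hsplit fun i => x i * pd i (pd i f) x,
      ← hsplit fun i => (1 + κ i.castSucc) * pd i f x, ← hsplit fun i => x i * pd i f x]
    ring
  have hκs : ∑ k, κ k = κ l.castSucc + ∑ i ∈ A, κ i.castSucc + κ (Fin.last (n + 2)) := by
    rw [Fin.sum_univ_castSucc, hsplit]
  have hK : ∑ i ∈ A, (1 + κ i.castSucc) = n + 1 + ∑ i ∈ A, κ i.castSucc := by
    rw [Finset.sum_add_distrib, Finset.sum_const, nsmul_one, hcard]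
  rw [hDk', hxx, hvv, hfv, hDP, hK, hfP, hκs, hsplit x]
  simp only [Finset.sum_add_distrib, Finset.sum_sub_distrib, ← Finset.mul_sum, hfP]
  push_cast
  field_simp
  ring
end
end

section
/- For d ≥ 2, κ_i ≥ 0 (i = 1,…,d+1) and 1 ≤ ℓ ≤ d, and for all twice continuously differentiable functions f and g on △^d: − ∫_{△^d} D_κ f(x) · g(x) W_κ(x) dx = Σ_{i=1, i≠ℓ}^d ∫_{△^d} ∂_i f(x) ∂_i g(x) x_i (1−|x|) W_κ(x) (dx/(1−x_ℓ)) + Σ_{1≤i<j≤d, i≠ℓ, j≠ℓ} ∫_{△^d} ∂_{i,j} f(x) ∂_{i,j} g(x) x_i x_j W_κ(x) (dx/(1−x_ℓ)) + ∫_{△^d} (⟨x,∇⟩ − ∂_ℓ) f(x) · (⟨x,∇⟩ − ∂_ℓ) g(x) x_ℓ W_κ(x) (dx/(1−x_ℓ)). -/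
open MeasureTheory Finset

noncomputable section

open Filter Topology

/-- The open simplex. -/
def OpenSplx (d : ℕ) : Set (Fin d → ℝ) := {x | (∀ i, 0 < x i) ∧ ∑ i, x i < 1}

theorem isOpen_openSplx (d : ℕ) : IsOpen (OpenSplx d) := by
  have h : OpenSplx d = (⋂ i, {x : Fin d → ℝ | 0 < x i}) ∩ {x | ∑ i, x i < 1} := by
    ext x; simp [OpenSplx]
  rw [h]
  exact (isOpen_iInter_of_finite fun i => isOpen_lt continuous_const (continuous_apply i)).inter
    (isOpen_lt (by fun_prop) continuous_const)

theorem openSplx_subset_splx (d : ℕ) : OpenSplx d ⊆ Splx d :=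
  fun _ hx => ⟨fun i => (hx.1 i).le, hx.2.le⟩

theorem isClosed_splx (d : ℕ) : IsClosed (Splx d) := by
  have h : Splx d = (⋂ i, {x : Fin d → ℝ | 0 ≤ x i}) ∩ {x | ∑ i, x i ≤ 1} := by
    ext x; simp [Splx]
  rw [h]
  exact (isClosed_iInter fun i => isClosed_le continuous_const (continuous_apply i)).inter
    (isClosed_le (by fun_prop) continuous_const)

theorem apply_le_one_of_mem_splx {d : ℕ} {x : Fin d → ℝ} (hx : x ∈ Splx d) (i : Fin d) :
    x i ≤ 1 :=
  (single_le_sum (fun j _ => hx.1 j) (mem_univ i)).trans hx.2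

theorem isCompact_splx (d : ℕ) : IsCompact (Splx d) := by
  refine (isCompact_Icc (a := (0 : Fin d → ℝ)) (b := 1)).of_isClosed_subset (isClosed_splx d) ?_
  exact fun x hx => ⟨hx.1, fun i => apply_le_one_of_mem_splx hx i⟩

theorem convex_splx (d : ℕ) : Convex ℝ (Splx d) := by
  intro x hx y hy a b ha hb hab
  refine ⟨fun i => ?_, ?_⟩
  · have := mul_nonneg ha (hx.1 i)
    have := mul_nonneg hb (hy.1 i)
    simp only [Pi.add_apply, Pi.smul_apply, smul_eq_mul]
    linarith
  · simp only [Pi.add_apply, Pi.smul_apply, smul_eq_mul, sum_add_distrib, ← mul_sum]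
    nlinarith [hx.2, hy.2]

theorem openSplx_nonempty (d : ℕ) : (OpenSplx d).Nonempty := by
  refine ⟨fun _ => 1 / ((d : ℝ) + 1), fun i => by positivity, ?_⟩
  simp only [sum_const, card_univ, Fintype.card_fin, nsmul_eq_mul]
  rw [mul_one_div, div_lt_one (by positivity)]
  linarith

theorem uniqueDiffOn_splx (d : ℕ) : UniqueDiffOn ℝ (Splx d) :=
  uniqueDiffOn_convex (convex_splx d) ((openSplx_nonempty d).mono
    ((isOpen_openSplx d).subset_interior_iff.2 (openSplx_subset_splx d)))

theorem splx_mem_nhds {d : ℕ} {x : Fin d → ℝ} (hx : x ∈ OpenSplx d) : Splx d ∈ 𝓝 x :=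
  mem_of_superset ((isOpen_openSplx d).mem_nhds hx) (openSplx_subset_splx d)

theorem interior_splx_subset {d : ℕ} (hd : d ≠ 0) : interior (Splx d) ⊆ OpenSplx d := by
  intro x hx
  have key : ∀ v : Fin d → ℝ, ∃ t : ℝ, 0 < t ∧ x + t • v ∈ Splx d := by
    intro v
    have hc : Tendsto (fun t : ℝ => x + t • v) (𝓝[>] 0) (𝓝 x) := by
      have : Continuous (fun t : ℝ => x + t • v) := by fun_prop
      simpa using (this.tendsto 0).mono_left nhdsWithin_le_nhds
    have := (hc.eventually (mem_interior_iff_mem_nhds.1 hx)).and self_mem_nhdsWithin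
    obtain ⟨t, h1, h2⟩ := this.exists
    exact ⟨t, h2, h1⟩
  refine ⟨fun i => ?_, ?_⟩
  · obtain ⟨t, ht, h⟩ := key (Pi.single i (-1))
    have := h.1 i
    simp at this
    linarith
  · obtain ⟨t, ht, h⟩ := key (fun _ => 1)
    have := h.2
    have hd' : (0 : ℝ) < d := by exact_mod_cast Nat.pos_of_ne_zero hd
    have := mul_pos hd' ht
    simp [sum_add_distrib] at *
    linarith

theorem setIntegral_splx_eq {d : ℕ} (hd : d ≠ 0) (h : (Fin d → ℝ) → ℝ) :
    ∫ x in Splx d, h x = ∫ x in OpenSplx d, h x := by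
  refine setIntegral_congr_set ?_
  refine (ae_eq_set.2 ⟨?_, ?_⟩)
  · refine measure_mono_null (t := frontier (Splx d)) ?_ ((convex_splx d).addHaar_frontier _)
    exact fun x hx => ⟨subset_closure hx.1, fun h => hx.2 (interior_splx_subset hd h)⟩
  · simp [Set.sdiff_eq_empty.2 (openSplx_subset_splx d)]

/-- Continuous and bounded on the open simplex. -/
def BddContOn {d : ℕ} (h : (Fin d → ℝ) → ℝ) : Prop :=
  ContinuousOn h (OpenSplx d) ∧ ∃ M, ∀ x ∈ OpenSplx d, |h x| ≤ M

namespace BddContOn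

variable {d : ℕ} {h k : (Fin d → ℝ) → ℝ}

theorem of_continuousOn_splx (hh : ContinuousOn h (Splx d)) : BddContOn h := by
  refine ⟨hh.mono (openSplx_subset_splx d), ?_⟩
  obtain ⟨M, hM⟩ := (isCompact_splx d).exists_bound_of_continuousOn hh
  exact ⟨M, fun x hx => hM x (openSplx_subset_splx d hx)⟩

theorem of_continuous (hh : Continuous h) : BddContOn h := of_continuousOn_splx hh.continuousOn

theorem congr (hh : BddContOn h) (e : Set.EqOn k h (OpenSplx d)) : BddContOn k := by
  obtain ⟨c, M, hM⟩ := hh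
  exact ⟨c.congr e, M, fun x hx => by rw [e hx]; exact hM x hx⟩

theorem add (hh : BddContOn h) (hk : BddContOn k) : BddContOn (fun x => h x + k x) := by
  obtain ⟨c, M, hM⟩ := hh
  obtain ⟨c', M', hM'⟩ := hk
  exact ⟨c.add c', M + M', fun x hx => (abs_add_le _ _).trans (add_le_add (hM x hx) (hM' x hx))⟩

theorem sub (hh : BddContOn h) (hk : BddContOn k) : BddContOn (fun x => h x - k x) := by
  obtain ⟨c, M, hM⟩ := hh
  obtain ⟨c', M', hM'⟩ := hk
  exact ⟨c.sub c', M + M', fun x hx => (abs_sub _ _).trans (add_le_add (hM x hx) (hM' x hx))⟩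

theorem mul (hh : BddContOn h) (hk : BddContOn k) : BddContOn (fun x => h x * k x) := by
  obtain ⟨c, M, hM⟩ := hh
  obtain ⟨c', M', hM'⟩ := hk
  refine ⟨c.mul c', M * M', fun x hx => ?_⟩
  rw [abs_mul]
  exact mul_le_mul (hM x hx) (hM' x hx) (abs_nonneg _) ((abs_nonneg _).trans (hM x hx))

theorem const (c : ℝ) : BddContOn (fun _ : Fin d → ℝ => c) := of_continuous continuous_const

theorem coord (i : Fin d) : BddContOn (fun x : Fin d → ℝ => x i) :=
  of_continuous (continuous_apply i)

theorem sum {ι : Type*} (s : Finset ι) {H : ι → (Fin d → ℝ) → ℝ} (hH : ∀ i ∈ s, BddContOn (H i)) :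
    BddContOn (fun x => ∑ i ∈ s, H i x) := by
  classical
  induction s using Finset.induction_on with
  | empty => simpa using const 0
  | insert a s ha ih =>
    simp only [sum_insert ha]
    exact (hH a (mem_insert_self a s)).add (ih fun i hi => hH i (mem_insert_of_mem hi))

theorem integrableOn (hh : BddContOn h) : IntegrableOn h (OpenSplx d) := by
  obtain ⟨c, M, hM⟩ := hh
  refine IntegrableOn.of_bound ?_ (c.aestronglyMeasurable (isOpen_openSplx d).measurableSet) M ?_
  · exact (measure_mono (openSplx_subset_splx d)).trans_lt (isCompact_splx d).measure_lt_top
  · exact (ae_restrict_iff' (isOpen_openSplx d).measurableSet).2 (ae_of_all _ hM)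

end BddContOn

theorem integral_eq_zero_of_hasLineDerivAt {d : ℕ} {U K : Set (Fin d → ℝ)} (hU : IsOpen U)
    (hK : IsCompact K) (hKU : K ⊆ U) {G G' : (Fin d → ℝ) → ℝ} {v : Fin d → ℝ}
    (hG : ∀ x ∈ U, HasLineDerivAt ℝ G (G' x) x v) (hc : ContinuousOn G U)
    (hc' : ContinuousOn G' U) (h0 : ∀ x ∈ U \ K, G x = 0) (h0' : ∀ x ∈ U \ K, G' x = 0) :
    IntegrableOn G' U ∧ ∫ x in U, G' x = 0 := by
  have int : ∀ H : (Fin d → ℝ) → ℝ, ContinuousOn H U → (∀ x ∈ U \ K, H x = 0) →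
      Integrable (U.indicator H) := fun H hH h0 =>
    (integrable_indicator_iff hU.measurableSet).2
      (((hH.mono hKU).integrableOn_compact hK).of_forall_sdiff_eq_zero hU.measurableSet h0)
  refine ⟨(integrable_indicator_iff hU.measurableSet).1 (int G' hc' h0'), ?_⟩
  have der : ∀ x, HasLineDerivAt ℝ (U.indicator G) (U.indicator G' x) x v := by
    intro x
    by_cases hx : x ∈ U
    · rw [Set.indicator_of_mem hx]
      refine (hG x hx).congr_of_eventuallyEq ?_
      filter_upwards [hU.mem_nhds hx] with y hy
      rw [Set.indicator_of_mem hy]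
    · rw [Set.indicator_of_notMem hx]
      have h : HasLineDerivAt ℝ (fun _ : Fin d → ℝ => (0 : ℝ)) 0 x v := hasDerivAt_const _ _
      refine h.congr_of_eventuallyEq ?_
      filter_upwards [hK.isClosed.isOpen_compl.mem_nhds (fun h => hx (hKU h))] with y hy
      by_cases hyU : y ∈ U
      · rw [Set.indicator_of_mem hyU, h0 y ⟨hyU, hy⟩]
      · rw [Set.indicator_of_notMem hyU]
  have one : ∀ x, HasLineDerivAt ℝ (fun _ : Fin d → ℝ => (1 : ℝ)) 0 x v :=
    fun _ => hasDerivAt_const _ _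
  have := integral_bilinear_hasLineDerivAt_right_eq_neg_left_of_integrable
    (μ := volume) (B := ContinuousLinearMap.mul ℝ ℝ) (f := fun _ => (1 : ℝ)) (f' := fun _ => 0)
    (g := U.indicator G) (g' := U.indicator G') (v := v) (by simp)
    (by simpa using int G' hc' h0') (by simpa using int G hc h0)
    (fun x _ => one x) (fun x _ => der x)
  rw [← integral_indicator hU.measurableSet]
  simpa using this

section LineDeriv

variable {d : ℕ} {F G : (Fin d → ℝ) → ℝ} {a b : ℝ} {x v : Fin d → ℝ}

theorem hasLineDerivAt_mul (hF : HasLineDerivAt ℝ F a x v) (hG : HasLineDerivAt ℝ G b x v) :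
    HasLineDerivAt ℝ (fun y => F y * G y) (a * G x + F x * b) x v := by
  simpa [HasLineDerivAt] using HasDerivAt.fun_mul hF hG

theorem hasLineDerivAt_sub (hF : HasLineDerivAt ℝ F a x v) (hG : HasLineDerivAt ℝ G b x v) :
    HasLineDerivAt ℝ (fun y => F y - G y) (a - b) x v :=
  HasDerivAt.fun_sub hF hG

theorem hasLineDerivAt_sum {ι : Type*} (s : Finset ι) {H : ι → (Fin d → ℝ) → ℝ} {c : ι → ℝ}
    (hH : ∀ i ∈ s, HasLineDerivAt ℝ (H i) (c i) x v) :
    HasLineDerivAt ℝ (fun y => ∑ i ∈ s, H i y) (∑ i ∈ s, c i) x v :=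
  HasDerivAt.fun_sum hH

theorem hasLineDerivAt_coord (i : Fin d) : HasLineDerivAt ℝ (fun y : Fin d → ℝ => y i) (v i) x v := by
  simpa [HasLineDerivAt] using ((hasDerivAt_id (0 : ℝ)).mul_const (v i)).const_add (x i)

theorem hasLineDerivAt_comp {φ : ℝ → ℝ} (hφ : HasDerivAt φ b (F x))
    (hF : HasLineDerivAt ℝ F a x v) : HasLineDerivAt ℝ (fun y => φ (F y)) (b * a) x v := by
  have h : HasDerivAt φ b (F (x + (0 : ℝ) • v)) := by simpa using hφ
  exact HasDerivAt.comp (0 : ℝ) h hF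

end LineDeriv

theorem pd_eqOn {d : ℕ} {f : (Fin d → ℝ) → ℝ} (i : Fin d) :
    Set.EqOn (pd i f) (fun x => fderivWithin ℝ f (Splx d) x (Pi.single i 1)) (OpenSplx d) := by
  intro x hx
  simp only [pd]
  rw [fderivWithin_of_mem_nhds (splx_mem_nhds hx)]

theorem contDiffOn_fderivWithin_splx {d : ℕ} {f : (Fin d → ℝ) → ℝ} {m n : WithTop ℕ∞}
    (hf : ContDiffOn ℝ n f (Splx d)) (hmn : m + 1 ≤ n) (i : Fin d) :
    ContDiffOn ℝ m (fun x => fderivWithin ℝ f (Splx d) x (Pi.single i 1)) (Splx d) :=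
  (hf.fderivWithin (uniqueDiffOn_splx d) hmn).clm_apply contDiffOn_const

theorem pd_congr {d : ℕ} {f g : (Fin d → ℝ) → ℝ} (h : Set.EqOn f g (OpenSplx d)) (i : Fin d) :
    Set.EqOn (pd i f) (pd i g) (OpenSplx d) := by
  intro x hx
  simp only [pd]
  rw [(h.eventuallyEq_of_mem ((isOpen_openSplx d).mem_nhds hx)).fderiv_eq]

theorem bddContOn_pd {d : ℕ} {f : (Fin d → ℝ) → ℝ} (hf : ContDiffOn ℝ 1 f (Splx d)) (i : Fin d) :
    BddContOn (pd i f) :=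
  (BddContOn.of_continuousOn_splx
    (contDiffOn_fderivWithin_splx (m := 0) hf (by simp) i).continuousOn).congr (pd_eqOn i)

theorem bddContOn_pd_pd {d : ℕ} {f : (Fin d → ℝ) → ℝ} (hf : ContDiffOn ℝ 2 f (Splx d))
    (i j : Fin d) : BddContOn (pd i (pd j f)) :=
  (bddContOn_pd (contDiffOn_fderivWithin_splx (m := 1) hf (by norm_num [one_add_one_eq_two]) j)
    i).congr (pd_congr (pd_eqOn j) i)

theorem hasLineDerivAt_pd {d : ℕ} {f : (Fin d → ℝ) → ℝ} (hf : ContDiffOn ℝ 1 f (Splx d))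
    {x : Fin d → ℝ} (hx : x ∈ OpenSplx d) (i : Fin d) :
    HasLineDerivAt ℝ f (pd i f x) x (Pi.single i 1) :=
  ((hf.contDiffAt (splx_mem_nhds hx)).differentiableAt one_ne_zero).hasFDerivAt.hasLineDerivAt _

theorem hasLineDerivAt_pd_pd {d : ℕ} {f : (Fin d → ℝ) → ℝ} (hf : ContDiffOn ℝ 2 f (Splx d))
    {x : Fin d → ℝ} (hx : x ∈ OpenSplx d) (i j : Fin d) :
    HasLineDerivAt ℝ (pd j f) (pd i (pd j f) x) x (Pi.single i 1) := by
  have h := hasLineDerivAt_pd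
    (contDiffOn_fderivWithin_splx (m := 1) hf (by norm_num [one_add_one_eq_two]) j) hx i
  rw [← pd_congr (pd_eqOn j) i hx] at h
  exact h.congr_of_eventuallyEq
    ((pd_eqOn j).eventuallyEq_of_mem ((isOpen_openSplx d).mem_nhds hx))

theorem pd_pd_comm {d : ℕ} {f : (Fin d → ℝ) → ℝ} (hf : ContDiffOn ℝ 2 f (Splx d))
    {x : Fin d → ℝ} (hx : x ∈ OpenSplx d) (i j : Fin d) :
    pd i (pd j f) x = pd j (pd i f) x := by
  have hc := hf.contDiffAt (splx_mem_nhds hx)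
  have hs := hc.isSymmSndFDerivAt (by simp)
  have hd : DifferentiableAt ℝ (fderiv ℝ f) x :=
    (hc.fderiv_right (m := 1) (by norm_num [one_add_one_eq_two])).differentiableAt one_ne_zero
  have e : ∀ i j, pd i (pd j f) x = fderiv ℝ (fderiv ℝ f) x (Pi.single i 1) (Pi.single j 1) := by
    intro i j
    unfold pd
    rw [fderiv_clm_apply hd (differentiableAt_const _)]
    simp
  rw [e, e]
  exact hs _ _

theorem continuous_Wk {d : ℕ} {κ : Fin (d+1) → ℝ} (hκ : ∀ i, 0 ≤ κ i) : Continuous (Wk κ) := by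
  unfold Wk
  refine (continuous_finsetProd _ fun i _ =>
    (continuous_apply i).rpow_const fun x => Or.inr (hκ _)).mul ?_
  exact Continuous.rpow_const (by fun_prop) fun x => Or.inr (hκ _)

theorem Wk_one {d : ℕ} (x : Fin d → ℝ) : Wk (fun _ => 1) x = (∏ i, x i) * (1 - ∑ i, x i) := by
  simp [Wk]

theorem hasLineDerivAt_Wk {d : ℕ} (κ : Fin (d+1) → ℝ) {x : Fin d → ℝ} (hx : x ∈ OpenSplx d)
    (i : Fin d) : HasLineDerivAt ℝ (Wk κ)
      (Wk κ x * (κ i.castSucc / x i - κ (Fin.last d) / (1 - ∑ k, x k))) x (Pi.single i 1) := by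
  have hpos : 0 < 1 - ∑ k, x k := by linarith [hx.2]
  have hlog : HasLineDerivAt ℝ (fun y : Fin d → ℝ => ∑ k, Real.log (y k) * κ k.castSucc
      + Real.log (1 - ∑ k, y k) * κ (Fin.last d))
      (κ i.castSucc / x i - κ (Fin.last d) / (1 - ∑ k, x k)) x (Pi.single i 1) := by
    have h1 : ∀ k ∈ (univ : Finset (Fin d)),
        HasLineDerivAt ℝ (fun y : Fin d → ℝ => Real.log (y k) * κ k.castSucc)
          ((x k)⁻¹ * (Pi.single i 1 : Fin d → ℝ) k * κ k.castSucc) x (Pi.single i 1) := fun k _ =>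
      HasDerivAt.mul_const (hasLineDerivAt_comp (F := fun y => y k)
        (Real.hasDerivAt_log (hx.1 k).ne') (hasLineDerivAt_coord k)) _
    have h2 : HasLineDerivAt ℝ (fun y : Fin d → ℝ => 1 - ∑ k, y k)
        (0 - ∑ k, (Pi.single i 1 : Fin d → ℝ) k) x (Pi.single i 1) :=
      hasLineDerivAt_sub (hasDerivAt_const _ _)
        (hasLineDerivAt_sum univ fun k _ => hasLineDerivAt_coord k)
    have h3 := HasDerivAt.mul_const (hasLineDerivAt_comp (F := fun y => 1 - ∑ k, y k)
      (Real.hasDerivAt_log hpos.ne') h2) (κ (Fin.last d))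
    have h4 := HasDerivAt.fun_add (hasLineDerivAt_sum univ h1) h3
    refine HasDerivAt.congr_deriv h4 ?_
    simp [Pi.single_apply]
    ring
  have hexp := hasLineDerivAt_comp (Real.hasDerivAt_exp _) hlog
  have key : Set.EqOn (Wk κ) (fun y : Fin d → ℝ => Real.exp (∑ k, Real.log (y k) * κ k.castSucc
      + Real.log (1 - ∑ k, y k) * κ (Fin.last d))) (OpenSplx d) := by
    intro y hy
    have hpos : 0 < 1 - ∑ k, y k := by linarith [hy.2]
    simp only [Wk, Real.exp_add, Real.exp_sum, Real.rpow_def_of_pos hpos]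
    congr 1
    exact prod_congr rfl fun k _ => Real.rpow_def_of_pos (hy.1 k) _
  have := hexp.congr_of_eventuallyEq
    (key.eventuallyEq_of_mem ((isOpen_openSplx d).mem_nhds hx))
  rw [show Wk κ x = _ from key hx]
  exact this

theorem exists_cutoff : ∃ η η' : ℝ → ℝ, (∀ t, HasDerivAt η (η' t) t) ∧ Continuous η' ∧
    (∀ t < 1, η t = 0 ∧ η' t = 0) ∧ (∀ t > 2, η t = 1 ∧ η' t = 0) ∧ (∀ t, |η t| ≤ 1) ∧
    ∃ C, ∀ t, |η' t * t| ≤ C := by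
  have hs : ContDiff ℝ 1 (fun t : ℝ => Real.smoothTransition (t - 1)) :=
    (Real.smoothTransition.contDiff (n := 1)).comp (contDiff_id.sub contDiff_const)
  have hlt : ∀ t : ℝ, t < 1 → Real.smoothTransition (t - 1) = 0 := fun t ht =>
    Real.smoothTransition.zero_of_nonpos (by linarith)
  have hgt : ∀ t : ℝ, 2 < t → Real.smoothTransition (t - 1) = 1 := fun t ht =>
    Real.smoothTransition.one_of_one_le (by linarith)
  have hlt' : ∀ t : ℝ, t < 1 → deriv (fun t : ℝ => Real.smoothTransition (t - 1)) t = 0 := by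
    intro t ht
    have : (fun t : ℝ => Real.smoothTransition (t - 1)) =ᶠ[𝓝 t] fun _ => 0 := by
      filter_upwards [Iio_mem_nhds ht] with s hs using hlt s hs
    rw [this.deriv_eq, deriv_const]
  have hgt' : ∀ t : ℝ, 2 < t → deriv (fun t : ℝ => Real.smoothTransition (t - 1)) t = 0 := by
    intro t ht
    have : (fun t : ℝ => Real.smoothTransition (t - 1)) =ᶠ[𝓝 t] fun _ => 1 := by
      filter_upwards [Ioi_mem_nhds ht] with s hs using hgt s hs
    rw [this.deriv_eq, deriv_const]
  have hc := hs.continuous_deriv le_rfl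
  refine ⟨_, _, fun t => (hs.differentiable one_ne_zero t).hasDerivAt, hc,
    fun t ht => ⟨hlt t ht, hlt' t ht⟩, fun t ht => ⟨hgt t ht, hgt' t ht⟩, fun t => ?_, ?_⟩
  · rw [abs_of_nonneg (Real.smoothTransition.nonneg _)]
    exact Real.smoothTransition.le_one _
  · obtain ⟨C, hC⟩ := (isCompact_Icc (a := (1 : ℝ)) (b := 2)).exists_bound_of_continuousOn
      (hc.mul continuous_id).continuousOn
    refine ⟨C, fun t => ?_⟩
    have hC0 : 0 ≤ C := (norm_nonneg _).trans (hC 1 (by norm_num))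
    rcases lt_or_ge t 1 with h1 | h1
    · simpa [hlt' t h1] using hC0
    rcases lt_or_ge 2 t with h2 | h2
    · simpa [hgt' t h2] using hC0
    exact hC t ⟨h1, h2⟩

/-- The components of the vector field whose divergence is `D_κ f · g · W_κ` plus the energy
density. -/
def flux {d : ℕ} (κ : Fin (d+1) → ℝ) (f g : (Fin d → ℝ) → ℝ) (i : Fin d) (x : Fin d → ℝ) : ℝ :=
  Wk κ x * (g x * (x i * (pd i f x - xgrad f x)))

/-- The `i`-th partial derivative of `flux κ f g i` on the open simplex. -/
def fluxDeriv {d : ℕ} (κ : Fin (d+1) → ℝ) (f g : (Fin d → ℝ) → ℝ) (i : Fin d)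
    (x : Fin d → ℝ) : ℝ :=
  Wk κ x * (κ i.castSucc / x i - κ (Fin.last d) / (1 - ∑ k, x k)) *
      (g x * (x i * (pd i f x - xgrad f x))) +
    Wk κ x * (pd i g x * (x i * (pd i f x - xgrad f x)) +
      g x * (1 * (pd i f x - xgrad f x) +
        x i * (pd i (pd i f) x - (pd i f x + ∑ j, x j * pd i (pd j f) x))))

/-- The energy density `∑ a_{ij} ∂_i f ∂_j g` with `a_{ij} = x_i δ_{ij} - x_i x_j`. -/
def energy {d : ℕ} (f g : (Fin d → ℝ) → ℝ) (x : Fin d → ℝ) : ℝ :=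
  ∑ i, pd i g x * (x i * (pd i f x - xgrad f x))

theorem hasLineDerivAt_flux {d : ℕ} (κ : Fin (d+1) → ℝ) {f g : (Fin d → ℝ) → ℝ}
    (hf : ContDiffOn ℝ 2 f (Splx d)) (hg : ContDiffOn ℝ 1 g (Splx d)) {x : Fin d → ℝ}
    (hx : x ∈ OpenSplx d) (i : Fin d) :
    HasLineDerivAt ℝ (flux κ f g i) (fluxDeriv κ f g i x) x (Pi.single i 1) := by
  have hgrad : HasLineDerivAt ℝ (xgrad f) (pd i f x + ∑ j, x j * pd i (pd j f) x) x
      (Pi.single i 1) := by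
    have := hasLineDerivAt_sum univ fun j _ => hasLineDerivAt_mul
      (hasLineDerivAt_coord (x := x) (v := Pi.single i 1) j) (hasLineDerivAt_pd_pd hf hx i j)
    refine HasDerivAt.congr_deriv this ?_
    simp [sum_add_distrib, Pi.single_apply]
  have hi : HasLineDerivAt ℝ (fun y : Fin d → ℝ => y i) 1 x (Pi.single i 1) :=
    HasDerivAt.congr_deriv (hasLineDerivAt_coord i) (by simp)
  exact hasLineDerivAt_mul (hasLineDerivAt_Wk κ hx i) (hasLineDerivAt_mul
    (hasLineDerivAt_pd hg hx i) (hasLineDerivAt_mul hi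
      (hasLineDerivAt_sub (hasLineDerivAt_pd_pd hf hx i i) hgrad)))

theorem sum_sum_eq_diag_add {d : ℕ} (H : Fin d → Fin d → ℝ) (hH : ∀ i j, H i j = H j i) :
    ∑ i, ∑ j, H i j = ∑ i, H i i + 2 * ∑ i, ∑ j ∈ univ.filter (fun j => i < j), H i j := by
  have h1 : ∀ i j, H i j = (if i = j then H i i else 0) + (if i < j then H i j else 0)
      + (if j < i then H j i else 0) := by
    intro i j
    rcases lt_trichotomy i j with h | h | h
    · simp [h, h.ne, h.not_gt]
    · simp [h]
    · simp [h, h.ne', h.not_gt, hH i j]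
  have h2 : ∑ i, ∑ j, H i j = ∑ i, ∑ j, ((if i = j then H i i else 0)
      + (if i < j then H i j else 0) + (if j < i then H j i else 0)) :=
    sum_congr rfl fun i _ => sum_congr rfl fun j _ => h1 i j
  rw [h2]
  simp only [sum_add_distrib, sum_filter]
  rw [sum_comm (f := fun i j => if j < i then H j i else 0)]
  simp
  ring

theorem sum_fluxDeriv {d : ℕ} (κ : Fin (d+1) → ℝ) {f : (Fin d → ℝ) → ℝ} (g : (Fin d → ℝ) → ℝ)
    (hf : ContDiffOn ℝ 2 f (Splx d)) {x : Fin d → ℝ} (hx : x ∈ OpenSplx d) :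
    ∑ i, fluxDeriv κ f g i x = Dk κ f x * g x * Wk κ x + energy f g x * Wk κ x := by
  have hpos : 1 - ∑ k, x k ≠ 0 := by linarith [hx.2]
  have hsym := sum_sum_eq_diag_add (fun i j => x i * x j * pd i (pd j f) x)
    fun i j => by rw [pd_pd_comm hf hx i j]; ring
  have hD : Dk κ f x = ∑ i, x i * pd i (pd i f) x - ∑ i, ∑ j, x i * x j * pd i (pd j f) x
      + ∑ i, κ i.castSucc * pd i f x + ∑ i, pd i f x
      - ((∑ i : Fin d, κ i.castSucc + κ (Fin.last d)) + d + 1) * xgrad f x := by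
    rw [hsym, Dk, Fin.sum_univ_castSucc, xgrad]
    have e1 : ∑ i, x i * (1 - x i) * pd i (pd i f) x =
      ∑ i, x i * pd i (pd i f) x - ∑ i, x i * x i * pd i (pd i f) x := by
      rw [← sum_sub_distrib]; exact sum_congr rfl fun i _ => by ring
    have e2 : ∀ c : ℝ, ∑ i, (κ i.castSucc + 1 - c * x i) * pd i f x =
      ∑ i, κ i.castSucc * pd i f x + ∑ i, pd i f x - c * ∑ i, x i * pd i f x := by
      intro c
      rw [mul_sum, ← sum_add_distrib, ← sum_sub_distrib]; exact sum_congr rfl fun i _ => by ring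
    rw [e1, e2]
    ring
  have hF : ∀ i, fluxDeriv κ f g i x = Wk κ x * g x * (κ i.castSucc * pd i f x
      - κ i.castSucc * xgrad f x - κ (Fin.last d) / (1 - ∑ k, x k) * (x i * pd i f x)
      + κ (Fin.last d) / (1 - ∑ k, x k) * xgrad f x * x i + pd i f x - xgrad f x
      + x i * pd i (pd i f) x - x i * pd i f x - ∑ j, x i * x j * pd i (pd j f) x)
      + Wk κ x * (pd i g x * (x i * (pd i f x - xgrad f x))) := by
    intro i
    have := (hx.1 i).ne'
    have e : ∑ j, x i * x j * pd i (pd j f) x = x i * ∑ j, x j * pd i (pd j f) x := by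
      rw [mul_sum]; exact sum_congr rfl fun j _ => by ring
    rw [e, fluxDeriv]
    generalize ∑ j, x j * pd i (pd j f) x = S
    generalize κ (Fin.last d) / (1 - ∑ k, x k) = c
    field_simp
    ring
  have hS : ∑ i, x i * pd i f x = xgrad f x := rfl
  simp only [hF, sum_add_distrib, sum_sub_distrib, ← mul_sum, ← sum_mul, hS, hD, energy, sum_const,
    card_univ, Fintype.card_fin, nsmul_eq_mul]
  field_simp
  ring

theorem bddContOn_Wk {d : ℕ} {κ : Fin (d+1) → ℝ} (hκ : ∀ i, 0 ≤ κ i) : BddContOn (Wk κ) :=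
  .of_continuous (continuous_Wk hκ)

theorem bddContOn_xgrad {d : ℕ} {f : (Fin d → ℝ) → ℝ} (hf : ContDiffOn ℝ 1 f (Splx d)) :
    BddContOn (xgrad f) :=
  .sum _ fun i _ => (BddContOn.coord i).mul (bddContOn_pd hf i)

theorem continuousOn_fluxDeriv {d : ℕ} {κ : Fin (d+1) → ℝ} (hκ : ∀ i, 0 ≤ κ i)
    {f g : (Fin d → ℝ) → ℝ} (hf : ContDiffOn ℝ 2 f (Splx d)) (hg : ContDiffOn ℝ 1 g (Splx d))
    (i : Fin d) : ContinuousOn (fluxDeriv κ f g i) (OpenSplx d) := by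
  have hf1 : ContDiffOn ℝ 1 f (Splx d) := hf.of_le (by norm_num)
  have hW := (bddContOn_Wk hκ).1
  have hfi := (bddContOn_pd hf1 i).1
  have hgi := (bddContOn_pd hg i).1
  have hs := (bddContOn_xgrad hf1).1
  have hgc := hg.continuousOn.mono (openSplx_subset_splx d)
  have hff := fun j => (bddContOn_pd_pd hf i j).1
  have h1 : ContinuousOn (fun x : Fin d → ℝ => κ i.castSucc / x i) (OpenSplx d) :=
    continuousOn_const.div (by fun_prop) fun x hx => (hx.1 i).ne'
  have h2 : ContinuousOn (fun x : Fin d → ℝ => κ (Fin.last d) / (1 - ∑ k, x k)) (OpenSplx d) :=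
    continuousOn_const.div (by fun_prop) fun x hx => by linarith [hx.2]
  have h3 : ContinuousOn (fun x => ∑ j, x j * pd i (pd j f) x) (OpenSplx d) :=
    continuousOn_finsetSum _ fun j _ => (continuous_apply j).continuousOn.mul (hff j)
  have h4 := hff i
  unfold fluxDeriv
  fun_prop

theorem isCompact_superlevel (d : ℕ) (c : ℝ) :
    IsCompact {x ∈ Splx d | 1 ≤ c * Wk (fun _ => 1) x} :=
  (isCompact_splx d).of_isClosed_subset ((isClosed_splx d).inter (isClosed_le continuous_const
    (continuous_const.mul (continuous_Wk fun _ => zero_le_one)))) fun _ hx => hx.1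

theorem superlevel_subset (d : ℕ) (c : ℝ) :
    {x ∈ Splx d | 1 ≤ c * Wk (fun _ => 1) x} ⊆ OpenSplx d := by
  rintro x ⟨hx, hp⟩
  have hne : Wk (fun _ => 1) x ≠ 0 := fun h => by simp [h] at hp; linarith
  rw [Wk_one] at hne
  refine ⟨fun i => (hx.1 i).lt_of_ne' ?_, hx.2.lt_of_ne fun h => hne (by simp [h])⟩
  exact prod_ne_zero_iff.1 (left_ne_zero_of_mul hne) i (mem_univ i)

theorem Wk_one_pos {d : ℕ} {x : Fin d → ℝ} (hx : x ∈ OpenSplx d) : 0 < Wk (fun _ => 1) x := by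
  rw [Wk_one]
  exact mul_pos (prod_pos fun i _ => hx.1 i) (by linarith [hx.2])

theorem integral_cutoff_eq_zero {d : ℕ} {κ : Fin (d+1) → ℝ} (hκ : ∀ i, 0 ≤ κ i)
    {f g : (Fin d → ℝ) → ℝ} (hf : ContDiffOn ℝ 2 f (Splx d)) (hg : ContDiffOn ℝ 1 g (Splx d))
    {η η' : ℝ → ℝ} (hη : ∀ t, HasDerivAt η (η' t) t) (hη' : Continuous η')
    (h0 : ∀ t < 1, η t = 0 ∧ η' t = 0) (c : ℝ) :
    ∫ x in OpenSplx d, (η (c * Wk (fun _ => 1) x) *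
        (Dk κ f x * g x * Wk κ x + energy f g x * Wk κ x) +
      η' (c * Wk (fun _ => 1) x) * (c * Wk (fun _ => 1) x) *
        (Wk κ x * g x * (∑ i, pd i f x - (d + 1) * xgrad f x))) = 0 := by
  have hf1 : ContDiffOn ℝ 1 f (Splx d) := hf.of_le (by norm_num)
  have hηc : Continuous η := continuous_iff_continuousAt.2 fun t => (hη t).continuousAt
  have hp : Continuous (Wk (fun _ : Fin (d+1) => (1 : ℝ))) := continuous_Wk fun _ => zero_le_one
  have small : ∀ x ∈ OpenSplx d \ {x ∈ Splx d | 1 ≤ c * Wk (fun _ => 1) x},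
      c * Wk (fun _ => 1) x < 1 := fun x hx => by
    by_contra! h
    exact hx.2 ⟨openSplx_subset_splx d hx.1, h⟩
  have key : ∀ i : Fin d, IntegrableOn (fun x => η' (c * Wk (fun _ => 1) x) *
        (c * (Wk (fun _ => 1) x * (1 / x i - 1 / (1 - ∑ k, x k)))) * flux κ f g i x +
        η (c * Wk (fun _ => 1) x) * fluxDeriv κ f g i x) (OpenSplx d) ∧
      ∫ x in OpenSplx d, (η' (c * Wk (fun _ => 1) x) *
        (c * (Wk (fun _ => 1) x * (1 / x i - 1 / (1 - ∑ k, x k)))) * flux κ f g i x +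
        η (c * Wk (fun _ => 1) x) * fluxDeriv κ f g i x) = 0 := by
    intro i
    have hflux : ContinuousOn (flux κ f g i) (OpenSplx d) := fun x hx => by
      have hW := (bddContOn_Wk hκ).1
      have hfi := (bddContOn_pd hf1 i).1
      have hs := (bddContOn_xgrad hf1).1
      have hgc := hg.continuousOn.mono (openSplx_subset_splx d)
      have : ContinuousOn (flux κ f g i) (OpenSplx d) := by
        unfold flux
        fun_prop
      exact this x hx
    have h1 : ContinuousOn (fun x : Fin d → ℝ => 1 / x i) (OpenSplx d) :=
      continuousOn_const.div (by fun_prop) fun x hx => (hx.1 i).ne'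
    have h2 : ContinuousOn (fun x : Fin d → ℝ => 1 / (1 - ∑ k, x k)) (OpenSplx d) :=
      continuousOn_const.div (by fun_prop) fun x hx => by linarith [hx.2]
    have h3 := continuousOn_fluxDeriv hκ hf hg i
    refine integral_eq_zero_of_hasLineDerivAt (v := Pi.single i 1)
      (G := fun x => η (c * Wk (fun _ => 1) x) * flux κ f g i x) (isOpen_openSplx d)
      (isCompact_superlevel d c) (superlevel_subset d c) ?_ ?_ ?_ ?_ ?_
    · intro x hx
      exact hasLineDerivAt_mul (hasLineDerivAt_comp (hη _)
        (HasDerivAt.const_mul c (hasLineDerivAt_Wk (fun _ => 1) hx i)))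
        (hasLineDerivAt_flux κ hf hg hx i)
    · fun_prop
    · fun_prop
    · intro x hx
      simp [(h0 _ (small x hx)).1]
    · intro x hx
      simp [(h0 _ (small x hx)).1, (h0 _ (small x hx)).2]
  have hsum := integral_finsetSum (μ := volume.restrict (OpenSplx d)) univ fun i _ => (key i).1
  rw [sum_eq_zero fun i _ => (key i).2] at hsum
  rw [← hsum]
  refine setIntegral_congr_fun (isOpen_openSplx d).measurableSet fun x hx => ?_
  have hpos : 1 - ∑ k, x k ≠ 0 := by linarith [hx.2]
  have hE : ∑ i, (1 / x i - 1 / (1 - ∑ k, x k)) * flux κ f g i x =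
      Wk κ x * g x * (∑ i, pd i f x - (d + 1) * xgrad f x) := by
    have hF : ∀ i, (1 / x i - 1 / (1 - ∑ k, x k)) * flux κ f g i x =
        Wk κ x * g x * (pd i f x - xgrad f x - 1 / (1 - ∑ k, x k) * (x i * pd i f x)
          + 1 / (1 - ∑ k, x k) * xgrad f x * x i) := by
      intro i
      have := (hx.1 i).ne'
      rw [flux]
      generalize 1 / (1 - ∑ k, x k) = c
      field_simp
      ring
    have hS : ∑ i, x i * pd i f x = xgrad f x := rfl
    simp only [hF, sum_add_distrib, sum_sub_distrib, ← mul_sum, hS, sum_const,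
      card_univ, Fintype.card_fin, nsmul_eq_mul]
    field_simp
    ring
  simp only [← sum_fluxDeriv κ g hf hx, ← hE, mul_sum, ← sum_add_distrib]
  exact sum_congr rfl fun i _ => by ring

theorem integral_Dk_add_energy {d : ℕ} {κ : Fin (d+1) → ℝ} (hκ : ∀ i, 0 ≤ κ i)
    {f g : (Fin d → ℝ) → ℝ} (hf : ContDiffOn ℝ 2 f (Splx d)) (hg : ContDiffOn ℝ 1 g (Splx d))
    (hD : BddContOn (fun x => Dk κ f x * g x * Wk κ x + energy f g x * Wk κ x)) :
    ∫ x in OpenSplx d, (Dk κ f x * g x * Wk κ x + energy f g x * Wk κ x) = 0 := by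
  obtain ⟨η, η', hη, hη', h0, h2, hη1, C, hC⟩ := exists_cutoff
  have hf1 : ContDiffOn ℝ 1 f (Splx d) := hf.of_le (by norm_num)
  have hE : BddContOn (fun x => Wk κ x * g x * (∑ i, pd i f x - (d + 1) * xgrad f x)) :=
    ((bddContOn_Wk hκ).mul (.of_continuousOn_splx hg.continuousOn)).mul
      ((BddContOn.sum _ fun i _ => bddContOn_pd hf1 i).sub ((BddContOn.const _).mul
        (bddContOn_xgrad hf1)))
  have hzero := integral_cutoff_eq_zero hκ hf hg hη hη' h0
  set D := fun x => Dk κ f x * g x * Wk κ x + energy f g x * Wk κ x with hDdef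
  set E := fun x => Wk κ x * g x * (∑ i, pd i f x - (d + 1) * xgrad f x)
  have hηc : Continuous η := continuous_iff_continuousAt.2 fun t => (hη t).continuousAt
  have hp : Continuous (Wk (fun _ : Fin (d+1) => (1 : ℝ))) := continuous_Wk fun _ => zero_le_one
  have hmeas := (isOpen_openSplx d).measurableSet
  have hlim := tendsto_integral_of_dominated_convergence (μ := volume.restrict (OpenSplx d))
    (F := fun (n : ℕ) x => η (n * Wk (fun _ => 1) x) * D x +
      η' (n * Wk (fun _ => 1) x) * (n * Wk (fun _ => 1) x) * E x) (f := D)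
    (fun x => |D x| + C * |E x|) ?_ ?_ ?_ ?_
  · exact tendsto_nhds_unique (hlim.congr fun n : ℕ => hzero n) tendsto_const_nhds
  · intro n
    have := hD.1
    have := hE.1
    refine ContinuousOn.aestronglyMeasurable ?_ hmeas
    fun_prop
  · exact hD.integrableOn.abs.add (hE.integrableOn.abs.const_mul C)
  · refine fun n => ae_of_all _ fun x => (norm_add_le _ _).trans (add_le_add ?_ ?_)
    · rw [Real.norm_eq_abs, abs_mul]
      exact mul_le_of_le_one_left (abs_nonneg _) (hη1 _)
    · rw [Real.norm_eq_abs, abs_mul]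
      exact mul_le_mul_of_nonneg_right (hC _) (abs_nonneg _)
  · refine (ae_restrict_iff' hmeas).2 (ae_of_all _ fun x hx => ?_)
    refine tendsto_const_nhds.congr' ?_
    have := (tendsto_natCast_atTop_atTop (R := ℝ)).atTop_mul_const (Wk_one_pos hx)
    filter_upwards [this.eventually_gt_atTop 2] with n hn
    simp [h2 _ hn]

theorem bddContOn_Dk {d : ℕ} (κ : Fin (d+1) → ℝ) {f : (Fin d → ℝ) → ℝ}
    (hf : ContDiffOn ℝ 2 f (Splx d)) : BddContOn (Dk κ f) := by
  have hf1 : ContDiffOn ℝ 1 f (Splx d) := hf.of_le (by norm_num)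
  have hc := fun i => BddContOn.coord (d := d) i
  have h1 := BddContOn.const (d := d) 1
  refine ((BddContOn.sum _ fun i _ => ?_).sub ((BddContOn.const 2).mul
    (.sum _ fun i _ => .sum _ fun j _ => ?_))).add (.sum _ fun i _ => ?_)
  · exact ((hc i).mul (h1.sub (hc i))).mul (bddContOn_pd_pd hf i i)
  · exact ((hc i).mul (hc j)).mul (bddContOn_pd_pd hf i j)
  · exact ((BddContOn.const _).sub ((BddContOn.const _).mul (hc i))).mul (bddContOn_pd hf1 i)

theorem bddContOn_energy {d : ℕ} {f g : (Fin d → ℝ) → ℝ} (hf : ContDiffOn ℝ 1 f (Splx d))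
    (hg : ContDiffOn ℝ 1 g (Splx d)) : BddContOn (energy f g) :=
  .sum _ fun i _ => (bddContOn_pd hg i).mul ((BddContOn.coord i).mul
    ((bddContOn_pd hf i).sub (bddContOn_xgrad hf)))

theorem add_apply_le_sum {d : ℕ} {x : Fin d → ℝ} (hx : x ∈ OpenSplx d) {i l : Fin d}
    (hil : i ≠ l) : x i + x l ≤ ∑ k, x k := by
  rw [← sum_pair hil]
  exact sum_le_sum_of_subset_of_nonneg (subset_univ _) fun k _ _ => (hx.1 k).le

theorem one_sub_apply_pos {d : ℕ} {x : Fin d → ℝ} (hx : x ∈ OpenSplx d) (l : Fin d) :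
    0 < 1 - x l := by
  have := single_le_sum (f := x) (fun j _ => (hx.1 j).le) (mem_univ l)
  linarith [hx.2]

theorem bddContOn_ratio {d : ℕ} {i l : Fin d} (hil : i ≠ l) :
    BddContOn (fun x : Fin d → ℝ => x i / (1 - x l)) := by
  refine ⟨ContinuousOn.div (by fun_prop) (by fun_prop) fun x hx => (one_sub_apply_pos hx l).ne',
    1, fun x hx => ?_⟩
  have hl := one_sub_apply_pos hx l
  rw [abs_of_nonneg (div_nonneg (hx.1 i).le hl.le), div_le_one hl]
  linarith [add_apply_le_sum hx hil, hx.2]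

theorem xgrad_sub_pd {d : ℕ} (f : (Fin d → ℝ) → ℝ) (l : Fin d) (x : Fin d → ℝ) :
    xgrad f x - pd l f x =
      ∑ i ∈ univ.filter (fun i => i ≠ l), x i * pd i f x - (1 - x l) * pd l f x := by
  rw [xgrad, ← sum_filter_add_sum_filter_not univ (fun i => i ≠ l)]
  simp [filter_eq']
  ring

theorem bddContOn_xgrad_sub_pd_div {d : ℕ} {f : (Fin d → ℝ) → ℝ}
    (hf : ContDiffOn ℝ 1 f (Splx d)) (l : Fin d) :
    BddContOn (fun x => (xgrad f x - pd l f x) / (1 - x l)) := by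
  refine BddContOn.congr (h := fun x => ∑ i ∈ univ.filter (fun i => i ≠ l),
    x i / (1 - x l) * pd i f x - pd l f x) ((BddContOn.sum _ fun i hi =>
      (bddContOn_ratio (mem_filter.1 hi).2).mul (bddContOn_pd hf i)).sub (bddContOn_pd hf l)) ?_
  intro x hx
  have hl := (one_sub_apply_pos hx l).ne'
  simp only [xgrad_sub_pd, sub_div, sum_div, div_mul_eq_mul_div]
  congr 1
  field_simp

/-- The pointwise decomposition of the energy density away from a fixed coordinate `l`. -/
theorem energy_eq {d : ℕ} (f g : (Fin d → ℝ) → ℝ) (l : Fin d) {x : Fin d → ℝ}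
    (hx : x ∈ OpenSplx d) : energy f g x =
      (∑ i ∈ univ.filter (fun i => i ≠ l), pd i f x * pd i g x * x i * (1 - ∑ k, x k) / (1 - x l)) +
      (∑ i ∈ univ.filter (fun i => i ≠ l), ∑ j ∈ univ.filter (fun j => i < j ∧ j ≠ l),
        pdd i j f x * pdd i j g x * x i * x j / (1 - x l)) +
      (xgrad f x - pd l f x) * (xgrad g x - pd l g x) * x l / (1 - x l) := by
  have hl := (one_sub_apply_pos hx l).ne'
  have split : ∀ h : Fin d → ℝ, ∑ i, h i = ∑ i ∈ univ.filter (fun i => i ≠ l), h i + h l := by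
    intro h
    rw [← sum_filter_add_sum_filter_not univ (fun i => i ≠ l)]
    simp [filter_eq']
  have hpair : 2 * ∑ i ∈ univ.filter (fun i => i ≠ l), ∑ j ∈ univ.filter (fun j => i < j ∧ j ≠ l),
      pdd i j f x * pdd i j g x * x i * x j =
      ∑ i ∈ univ.filter (fun i => i ≠ l), ∑ j ∈ univ.filter (fun j => j ≠ l),
        pdd i j f x * pdd i j g x * x i * x j := by
    have := sum_sum_eq_diag_add (fun i j => if i ≠ l ∧ j ≠ l then
      pdd i j f x * pdd i j g x * x i * x j else 0) (fun i j => by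
        simp only [and_comm (a := i ≠ l), pdd]
        split_ifs <;> ring)
    have hz : ∀ i, pdd i i f x = 0 := fun i => sub_self _
    simp only [hz, zero_mul, ite_self, sum_const_zero, zero_add] at this
    simp only [sum_filter, ← ite_and] at this ⊢
    refine Eq.trans ?_ (this.symm.trans ?_)
    · congr 1
      refine sum_congr rfl fun i _ => ?_
      split_ifs with hi
      · refine sum_congr rfl fun j _ => ?_
        simp [hi, ite_and]
      · simp [hi]
    · refine sum_congr rfl fun i _ => ?_
      split_ifs with hi
      · simp [hi]
      · simp [hi]
  set s := univ.filter (fun i => i ≠ l) with hs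
  have hexp : ∑ i ∈ s, ∑ j ∈ s, pdd i j f x * pdd i j g x * x i * x j =
      2 * ((∑ i ∈ s, x i) * (∑ i ∈ s, x i * pd i f x * pd i g x)
        - (∑ i ∈ s, x i * pd i f x) * (∑ i ∈ s, x i * pd i g x)) := by
    have e : ∀ i j, pdd i j f x * pdd i j g x * x i * x j =
        (x i * pd i f x * pd i g x) * x j + x i * (x j * pd j f x * pd j g x)
        - (x i * pd i f x) * (x j * pd j g x) - (x i * pd i g x) * (x j * pd j f x) := by
      intro i j
      simp only [pdd]
      ring
    simp only [e, sum_add_distrib, sum_sub_distrib, ← sum_mul_sum]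
    ring
  have hpair' : ∑ i ∈ s, ∑ j ∈ univ.filter (fun j => i < j ∧ j ≠ l),
      pdd i j f x * pdd i j g x * x i * x j = (∑ i ∈ s, x i) * (∑ i ∈ s, x i * pd i f x * pd i g x)
        - (∑ i ∈ s, x i * pd i f x) * (∑ i ∈ s, x i * pd i g x) := by
    linarith
  have h1 : ∑ i ∈ s, pd i f x * pd i g x * x i * (1 - ∑ k, x k) =
      (∑ i ∈ s, x i * pd i f x * pd i g x) * (1 - ∑ k, x k) := by
    rw [sum_mul]
    exact sum_congr rfl fun i _ => by ring
  have h0 : energy f g x = ∑ i, x i * pd i f x * pd i g x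
      - (∑ i, x i * pd i f x) * ∑ i, x i * pd i g x := by
    have hS : ∑ i, x i * pd i f x = xgrad f x := rfl
    rw [energy, hS, mul_sum, ← sum_sub_distrib]
    exact sum_congr rfl fun i _ => by ring
  simp only [← sum_div]
  rw [hpair', h1, h0, xgrad_sub_pd, xgrad_sub_pd, ← hs, split, split (fun i => x i * pd i f x),
    split (fun i => x i * pd i g x), split x]
  field_simp
  ring

/-- the integral identity \eqref{eq:self-adj3}, for `1 ≤ ℓ ≤ d`. -/
theorem stmt10 (d : ℕ) (hd : 2 ≤ d) (κ : Fin (d+1) → ℝ) (hκ : ∀ i, 0 ≤ κ i)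
    (l : Fin d) (f g : (Fin d → ℝ) → ℝ)
    (hf : ContDiffOn ℝ 2 f (Splx d)) (hg : ContDiffOn ℝ 2 g (Splx d)) :
    -∫ x in Splx d, Dk κ f x * g x * Wk κ x =
      (∑ i ∈ Finset.univ.filter (fun i => i ≠ l),
        ∫ x in Splx d, pd i f x * pd i g x * x i * (1 - ∑ k, x k) * Wk κ x / (1 - x l)) +
      (∑ i ∈ Finset.univ.filter (fun i => i ≠ l),
        ∑ j ∈ Finset.univ.filter (fun j => i < j ∧ j ≠ l),
          ∫ x in Splx d, pdd i j f x * pdd i j g x * x i * x j * Wk κ x / (1 - x l)) +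
      ∫ x in Splx d,
        (xgrad f x - pd l f x) * (xgrad g x - pd l g x) * x l * Wk κ x / (1 - x l) := by
  have hd0 : d ≠ 0 := by omega
  have hf1 : ContDiffOn ℝ 1 f (Splx d) := hf.of_le (by norm_num)
  have hg1 : ContDiffOn ℝ 1 g (Splx d) := hg.of_le (by norm_num)
  simp only [setIntegral_splx_eq hd0]
  have hW := bddContOn_Wk hκ
  have hDk := ((bddContOn_Dk κ hf).mul (.of_continuousOn_splx hg.continuousOn)).mul hW
  have hEn := (bddContOn_energy hf1 hg1).mul hW
  have hzero := integral_Dk_add_energy hκ hf hg1 (hDk.add hEn)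
  rw [integral_add hDk.integrableOn hEn.integrableOn] at hzero
  have hT1 : ∀ i ∈ univ.filter (fun i => i ≠ l), IntegrableOn (fun x : Fin d → ℝ =>
      pd i f x * pd i g x * x i * (1 - ∑ k, x k) * Wk κ x / (1 - x l)) (OpenSplx d) := by
    intro i hi
    refine (((((bddContOn_pd hf1 i).mul (bddContOn_pd hg1 i)).mul
      (bddContOn_ratio (mem_filter.1 hi).2)).mul
      (.of_continuous (h := fun x => 1 - ∑ k, x k) (by fun_prop))).mul hW).congr
      (fun x hx => ?_) |>.integrableOn
    ring
  have hT2 : ∀ i ∈ univ.filter (fun i => i ≠ l), ∀ j ∈ univ.filter (fun j => i < j ∧ j ≠ l),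
      IntegrableOn (fun x : Fin d → ℝ =>
        pdd i j f x * pdd i j g x * x i * x j * Wk κ x / (1 - x l)) (OpenSplx d) := by
    intro i hi j _
    refine ((((((bddContOn_pd hf1 i).sub (bddContOn_pd hf1 j)).mul
      ((bddContOn_pd hg1 i).sub (bddContOn_pd hg1 j))).mul
      (bddContOn_ratio (mem_filter.1 hi).2)).mul (.coord j)).mul hW).congr
      (fun x hx => ?_) |>.integrableOn
    simp only [pdd]
    ring
  have hT3 : IntegrableOn (fun x : Fin d → ℝ =>
      (xgrad f x - pd l f x) * (xgrad g x - pd l g x) * x l * Wk κ x / (1 - x l))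
      (OpenSplx d) := by
    refine ((((bddContOn_xgrad_sub_pd_div hf1 l).mul ((bddContOn_xgrad hg1).sub
      (bddContOn_pd hg1 l))).mul (.coord l)).mul hW).congr (fun x hx => ?_) |>.integrableOn
    ring
  have hT2' : ∀ i ∈ univ.filter (fun i => i ≠ l), IntegrableOn (fun x : Fin d → ℝ =>
      ∑ j ∈ univ.filter (fun j => i < j ∧ j ≠ l),
        pdd i j f x * pdd i j g x * x i * x j * Wk κ x / (1 - x l)) (OpenSplx d) :=
    fun i hi => integrable_finsetSum _ (hT2 i hi)
  rw [← integral_finsetSum _ hT1, sum_congr rfl fun i hi => (integral_finsetSum _ (hT2 i hi)).symm,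
    ← integral_finsetSum _ hT2', ← integral_add (integrable_finsetSum _ hT1)
      (integrable_finsetSum _ hT2'), ← integral_add ((integrable_finsetSum _ hT1).fun_add
      (integrable_finsetSum _ hT2')) hT3, neg_eq_of_add_eq_zero_right hzero]
  refine setIntegral_congr_fun (isOpen_openSplx d).measurableSet fun x hx => ?_
  simp only [energy_eq f g l hx, add_mul, sum_mul, div_mul_eq_mul_div]
end
end
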